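/- Let η > 0, −1/2 < s < 0, 0 < T ≤ 1, and let S(t) be the semigroup on periodic Sobolev spaces with symbol e^{(iβk|k|−η(k²−|k|))t}. For u, v in the space X_T^s of continuous curves [0,T] → H^s(𝕋) with finite norm ‖u‖_{X_T^s} = sup_{t∈(0,T]}(‖u(t)‖_{H^s} + t^{|s|/2}‖u(t)‖_{L²}), the Duhamel term satisfies ‖∫_0^t S(t−t') ∂_x(u v)(t') dt'‖_{X_T^s} ≤ C(s,η) T^{(1+2s)/4} ‖u‖_{X_T^s} ‖v‖_{X_T^s}. -/

import Mathlib

/-- The H^s(𝕋) norm, expressed through the Fourier coefficients. -/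
noncomputable def hsNorm (s : ℝ) (f : ℤ → ℂ) : ℝ :=
  Real.sqrt (2 * Real.pi * ∑' k : ℤ, (1 + (k:ℝ) ^ 2) ^ s * ‖f k‖ ^ 2)

/-- The L²(𝕋) norm, expressed through the Fourier coefficients. -/
noncomputable def l2Norm (f : ℤ → ℂ) : ℝ :=
  Real.sqrt (2 * Real.pi * ∑' k : ℤ, ‖f k‖ ^ 2)

/-- The Fourier symbol `e^{(iβk|k| − η(k²−|k|)) t}` of the Chen–Lee semigroup `S(t)`. -/
noncomputable def semigroupSymbol (β η t : ℝ) (k : ℤ) : ℂ :=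
  Complex.exp ((Complex.I * (β * (k:ℝ) * |(k:ℝ)| : ℝ) -
    ((η * ((k:ℝ) ^ 2 - |(k:ℝ)|) : ℝ) : ℂ)) * (t : ℝ))

/-- The X_T^s norm `‖u‖ = sup_{t∈(0,T]} (‖u(t)‖_{H^s} + t^{|s|/2} ‖u(t)‖_{L²})`
of a curve of Fourier coefficients `u : ℝ → ℤ → ℂ`. -/
noncomputable def xNorm (s T : ℝ) (u : ℝ → ℤ → ℂ) : ℝ :=
  ⨆ t : Set.Ioc (0:ℝ) T, (hsNorm s (u t) + (t : ℝ) ^ (|s| / 2) * l2Norm (u t))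

/-- The k-th Fourier coefficient of the Duhamel term
`∫_0^t S(t−t') ∂ₓ(uv)(t') dt'`, namely
`∫_0^t e^{(iq(k)−p(k))(t−t')} (ik) (û(t') * v̂(t'))(k) dt'`. -/
noncomputable def duhamel (β η : ℝ) (u v : ℝ → ℤ → ℂ) (t : ℝ) (k : ℤ) : ℂ :=
  ∫ t' in Set.Ioo (0:ℝ) t,
    semigroupSymbol β η (t - t') k *
      (Complex.I * (k:ℝ) * ∑' j : ℤ, u t' j * v t' (k - j))

lemma aux_nat (h : ℝ) (h0 : 0 < h) (h1 : h ≤ 1) (g : ℕ → ℝ) (g0 : ∀ n, 0 ≤ g n)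
    (hg : ∀ n : ℕ, g n ≤ 1 / (1 + h ^ 2 * (n:ℝ) ^ 2)) :
    Summable g ∧ ∑' n, g n ≤ 4 / h := by
  have key : ∀ n : ℕ, g n ≤ 4 / h * (1 / (1 + h * n) - 1 / (1 + h * (n + 1 : ℕ))) := by
    intro n
    refine (hg n).trans ?_
    have hn : (0:ℝ) ≤ n := n.cast_nonneg
    have e : 4 / h * (1 / (1 + h * n) - 1 / (1 + h * (n + 1 : ℕ)))
        = 4 / ((1 + h * n) * (1 + h * (n + 1))) := by
      push_cast
      field_simp
      ring
    rw [e, div_le_div_iff₀ (by positivity) (by positivity)]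
    have := mul_nonneg h0.le hn
    nlinarith [sq_nonneg (h * n - 1), mul_nonneg this (sub_nonneg.2 h1)]
  have part : ∀ N : ℕ, ∑ n ∈ Finset.range N, g n ≤ 4 / h := by
    intro N
    refine (Finset.sum_le_sum (fun n _ => key n)).trans ?_
    rw [← Finset.mul_sum, Finset.sum_range_sub' (fun n : ℕ => 1 / (1 + h * (n:ℝ)))]
    have : (0:ℝ) ≤ 1 / (1 + h * N) := by positivity
    have h4 : 0 < 4 / h := by positivity
    simp only [Nat.cast_zero, mul_zero, add_zero, div_one]
    nlinarith
  exact ⟨summable_of_sum_range_le g0 part, Real.tsum_le_of_sum_range_le g0 part⟩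

lemma aux_int (t : ℝ) (h0 : 0 < t) (h1 : t ≤ 1) :
    Summable (fun k : ℤ => 1 / (1 + t * (k:ℝ) ^ 2)) ∧
    ∑' k : ℤ, 1 / (1 + t * (k:ℝ) ^ 2) ≤ 8 * t ^ (-(1/2) : ℝ) := by
  have hh : √t ^ 2 = t := Real.sq_sqrt h0.le
  have hp : 0 < √t := Real.sqrt_pos.2 h0
  have hl : √t ≤ 1 := Real.sqrt_le_one.2 h1
  obtain ⟨a1, a2⟩ := aux_nat √t hp hl (fun n => 1 / (1 + t * (((n:ℤ):ℝ)) ^ 2))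
    (fun n => by positivity) (fun n => by rw [hh]; simp)
  obtain ⟨b1, b2⟩ := aux_nat √t hp hl (fun n => 1 / (1 + t * (((-((n:ℤ)+1) : ℤ):ℝ)) ^ 2))
    (fun n => by positivity) (fun n => by
      rw [hh]
      apply one_div_le_one_div_of_le (by positivity)
      push_cast
      have : (0:ℝ) ≤ n := n.cast_nonneg
      nlinarith)
  have hs := HasSum.of_nat_of_neg_add_one (f := fun k : ℤ => 1 / (1 + t * (k:ℝ) ^ 2))
    a1.hasSum b1.hasSum
  refine ⟨hs.summable, ?_⟩
  rw [hs.tsum_eq, Real.rpow_neg h0.le, ← Real.sqrt_eq_rpow]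
  have : 8 * (√t)⁻¹ = 4 / √t + 4 / √t := by ring
  rw [this]
  exact add_le_add a2 b2

lemma aux_exp (y : ℝ) (hy : 0 ≤ y) : Real.exp (-y) ≤ 2 / (1 + y) ^ 2 := by
  rw [Real.exp_neg, inv_eq_one_div, div_le_div_iff₀ (Real.exp_pos _) (by positivity)]
  nlinarith [Real.quadratic_le_exp_of_nonneg hy]

/-- the time integral -/
lemma aux_integral (s a t : ℝ) (hs1 : -(1/2) < s) (hs2 : s < 0) (ha : 0 ≤ a) (ht : 0 < t)
    (f : ℝ → ℂ) (M : ℝ) (hM : 0 ≤ M)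
    (hf : ∀ r ∈ Set.Ioo 0 t, ‖f r‖ ≤ M * (Real.exp (-(a * (t - r))) * r ^ s)) :
    ‖∫ r in Set.Ioo 0 t, f r‖ ≤ M * (8 * t ^ (1 + s) / (1 + a * t)) := by
  have hd : ∀ r ∈ Set.uIcc 0 t, HasDerivAt (fun r => -((t - r) / (1 + a * (t - r))))
      (1 / (1 + a * (t - r)) ^ 2) r := by
    intro r hr
    rw [Set.uIcc_of_le ht.le] at hr
    have hpos : 0 < 1 + a * (t - r) := by
      have := mul_nonneg ha (sub_nonneg.2 hr.2)
      linarith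
    have h1 : HasDerivAt (fun r => t - r) (-1) r := by
      simpa using (hasDerivAt_id r).const_sub t
    have h2 : HasDerivAt (fun r => 1 + a * (t - r)) (a * (-1)) r :=
      (h1.const_mul a).const_add 1
    have h3 := (h1.fun_div h2 hpos.ne').fun_neg
    have h4 : -((-1 * (1 + a * (t - r)) - (t - r) * (a * -1)) / (1 + a * (t - r)) ^ 2)
        = 1 / (1 + a * (t - r)) ^ 2 := by
      rw [← neg_div]
      congr 1
      ring
    rw [← h4]
    exact h3
  have hc : ContinuousOn (fun r => 1 / (1 + a * (t - r)) ^ 2) (Set.uIcc 0 t) := by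
    apply ContinuousOn.div (by fun_prop) (by fun_prop)
    intro r hr
    rw [Set.uIcc_of_le ht.le] at hr
    have := mul_nonneg ha (sub_nonneg.2 hr.2)
    positivity
  have i1 : IntervalIntegrable (fun r => 1 / (1 + a * (t - r)) ^ 2) MeasureTheory.volume 0 t :=
    hc.intervalIntegrable
  have e1 : ∫ r in (0:ℝ)..t, 1 / (1 + a * (t - r)) ^ 2 = t / (1 + a * t) := by
    rw [intervalIntegral.integral_eq_sub_of_hasDerivAt hd i1]
    simp
  have i2 : IntervalIntegrable (fun r : ℝ => r ^ s) MeasureTheory.volume 0 t :=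
    intervalIntegral.intervalIntegrable_rpow' (by linarith)
  have e2 : ∫ r in (0:ℝ)..t, r ^ s = t ^ (s + 1) / (s + 1) := by
    rw [integral_rpow (Or.inl (by linarith)), Real.zero_rpow (by linarith), sub_zero]
  set A := M * (2 * (t / 2) ^ s) with hA
  set B := M * Real.exp (-(a * t / 2)) with hB
  have i3 := (i1.const_mul A).add (i2.const_mul B)
  have e3 : ∫ r in Set.Ioo 0 t, (A * (1 / (1 + a * (t - r)) ^ 2) + B * r ^ s)
      = A * (t / (1 + a * t)) + B * (t ^ (s + 1) / (s + 1)) := by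
    rw [← MeasureTheory.integral_Ioc_eq_integral_Ioo, ← intervalIntegral.integral_of_le ht.le,
      intervalIntegral.integral_add (i1.const_mul A) (i2.const_mul B),
      intervalIntegral.integral_const_mul, intervalIntegral.integral_const_mul, e1, e2]
  have b : ‖∫ r in Set.Ioo 0 t, f r‖
      ≤ ∫ r in Set.Ioo 0 t, (A * (1 / (1 + a * (t - r)) ^ 2) + B * r ^ s) := by
    apply MeasureTheory.norm_integral_le_of_norm_le
    · exact (((intervalIntegrable_iff_integrableOn_Ioc_of_le ht.le).1 i3).mono_set
        Set.Ioo_subset_Ioc_self)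
    · rw [MeasureTheory.ae_restrict_iff' measurableSet_Ioo]
      refine Filter.Eventually.of_forall fun r hr => (hf r hr).trans ?_
      have hp : 0 ≤ r ^ s := Real.rpow_nonneg hr.1.le _
      have hq : 0 ≤ (t/2) ^ s := Real.rpow_nonneg (by linarith) _
      have hm := mul_nonneg ha (sub_nonneg.2 hr.2.le)
      have : Real.exp (-(a * (t - r))) * r ^ s ≤
        2 * (t / 2) ^ s * (1 / (1 + a * (t - r)) ^ 2) + Real.exp (-(a * t / 2)) * r ^ s := by
        rcases le_total (t / 2) r with h | h
        · have h1 : r ^ s ≤ (t/2) ^ s :=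
            Real.rpow_le_rpow_of_nonpos (by linarith) h hs2.le
          have h2 := mul_le_mul (aux_exp _ hm) h1 hp (by positivity)
          have h3 : 0 ≤ Real.exp (-(a * t / 2)) * r ^ s := by positivity
          calc _ ≤ _ := h2
            _ = 2 * (t / 2) ^ s * (1 / (1 + a * (t - r)) ^ 2) := by ring
            _ ≤ _ := by linarith
        · have h1 : Real.exp (-(a * (t - r))) ≤ Real.exp (-(a * t / 2)) := by
            apply Real.exp_le_exp.2
            nlinarith
          have h3 : 0 ≤ 2 * (t / 2) ^ s * (1 / (1 + a * (t - r)) ^ 2) := by positivity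
          have := mul_le_mul_of_nonneg_right h1 hp
          linarith
      calc _ ≤ M * _ := mul_le_mul_of_nonneg_left this hM
        _ = _ := by rw [hA, hB]; ring
  refine b.trans ?_
  rw [e3, hA, hB]
  have c1 : (t / 2) ^ s ≤ 2 * t ^ s := by
    rw [Real.div_rpow ht.le (by norm_num), div_eq_mul_inv, ← Real.rpow_neg (by norm_num), mul_comm]
    apply mul_le_mul_of_nonneg_right _ (Real.rpow_nonneg ht.le _)
    calc (2:ℝ) ^ (-s) ≤ 2 ^ (1:ℝ) := Real.rpow_le_rpow_of_exponent_le (by norm_num) (by linarith)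
      _ = 2 := by simp
  have c2 : t ^ (s + 1) = t ^ s * t := by rw [Real.rpow_add ht, Real.rpow_one]
  have c2' : t ^ (1 + s) = t ^ s * t := by rw [add_comm, c2]
  have hat : 0 ≤ a * t := by positivity
  have c3 : Real.exp (-(a * t / 2)) ≤ 2 / (1 + a * t) := by
    rw [Real.exp_neg, inv_eq_one_div, div_le_div_iff₀ (Real.exp_pos _) (by positivity)]
    nlinarith [Real.add_one_le_exp (a * t / 2)]
  have c4 : t ^ (s + 1) / (s + 1) ≤ 2 * (t ^ s * t) := by
    rw [c2, div_le_iff₀ (by linarith)]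
    have : 0 < t ^ s * t := by positivity
    nlinarith
  have c5 : 0 ≤ t ^ (s + 1) / (s + 1) := by
    have : 0 < s + 1 := by linarith
    positivity
  have d1 : (t / 2) ^ s * (t / (1 + a * t)) ≤ 2 * t ^ s * (t / (1 + a * t)) :=
    mul_le_mul_of_nonneg_right c1 (by positivity)
  have d2 : Real.exp (-(a * t / 2)) * (t ^ (s + 1) / (s + 1))
      ≤ 2 / (1 + a * t) * (2 * (t ^ s * t)) := mul_le_mul c3 c4 c5 (by positivity)
  calc _ = M * (2 * ((t / 2) ^ s * (t / (1 + a * t)))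
        + Real.exp (-(a * t / 2)) * (t ^ (s + 1) / (s + 1))) := by ring
    _ ≤ M * (2 * (2 * t ^ s * (t / (1 + a * t))) + 2 / (1 + a * t) * (2 * (t ^ s * t))) := by
        gcongr
    _ = _ := by rw [c2']; ring

lemma aux_l2 (f : ℤ → ℂ) : √(∑' k : ℤ, ‖f k‖ ^ 2) ≤ l2Norm f := by
  unfold l2Norm
  apply Real.sqrt_le_sqrt
  have : 0 ≤ ∑' k : ℤ, ‖f k‖ ^ 2 := tsum_nonneg fun k => by positivity
  nlinarith [Real.pi_gt_three]

lemma aux_conv (f g : ℤ → ℂ) (hf : Summable fun k : ℤ => ‖f k‖ ^ 2)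
    (hg : Summable fun k : ℤ => ‖g k‖ ^ 2) (k : ℤ) :
    ‖∑' j : ℤ, f j * g (k - j)‖ ≤ l2Norm f * l2Norm g := by
  have hg' : Summable fun j : ℤ => ‖g (k - j)‖ ^ 2 :=
    (Equiv.subLeft k).summable_iff (f := fun j : ℤ => ‖g j‖ ^ 2) |>.2 hg
  have eg : ∑' j : ℤ, ‖g (k - j)‖ ^ 2 = ∑' j : ℤ, ‖g j‖ ^ 2 :=
    (Equiv.subLeft k).tsum_eq (fun j : ℤ => ‖g j‖ ^ 2)
  have hsum' := Real.summable_mul_of_Lp_Lq_of_nonneg (f := fun j : ℤ => ‖f j‖)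
    (g := fun j : ℤ => ‖g (k - j)‖) (p := 2) (q := 2) (by constructor <;> norm_num)
    (fun j => norm_nonneg _) (fun j => norm_nonneg _)
    (by simpa using hf) (by simpa using hg')
  have H := Real.inner_le_Lp_mul_Lq_tsum_of_nonneg (f := fun j : ℤ => ‖f j‖)
    (g := fun j : ℤ => ‖g (k - j)‖) (p := 2) (q := 2) (by constructor <;> norm_num)
    (fun j => norm_nonneg _) (fun j => norm_nonneg _)
    (by simpa using hf) (by simpa using hg')
  simp only [Real.rpow_two, ← Real.sqrt_eq_rpow, eg] at H
  have hsum : Summable fun j : ℤ => ‖f j * g (k - j)‖ := by simpa using hsum'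
  refine (norm_tsum_le_tsum_norm hsum).trans ?_
  simp only [norm_mul]
  exact H.trans (mul_le_mul (aux_l2 f) (aux_l2 g) (Real.sqrt_nonneg _) (Real.sqrt_nonneg _))

lemma aux_symbol (β η t : ℝ) (k : ℤ) :
    ‖semigroupSymbol β η t k‖ = Real.exp (-(η * ((k:ℝ) ^ 2 - |(k:ℝ)|) * t)) := by
  unfold semigroupSymbol
  rw [Complex.norm_exp]
  congr 1
  rw [Complex.re_mul_ofReal, Complex.sub_re, Complex.I_mul_re, Complex.ofReal_im, Complex.ofReal_re]
  ring

lemma aux_xnorm_nonneg (s T : ℝ) (u : ℝ → ℤ → ℂ) : 0 ≤ xNorm s T u := by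
  apply Real.iSup_nonneg
  intro t
  have := t.2.1
  unfold hsNorm l2Norm
  positivity

lemma aux_xnorm (s T : ℝ) (u : ℝ → ℤ → ℂ) (h : BddAbove (Set.range fun t : Set.Ioc (0:ℝ) T =>
        hsNorm s (u t) + (t : ℝ) ^ (|s| / 2) * l2Norm (u t))) (hs : s < 0)
    (t : ℝ) (ht : t ∈ Set.Ioc 0 T) : l2Norm (u t) ≤ t ^ (s / 2) * xNorm s T u := by
  have h1 : hsNorm s (u t) + t ^ (|s| / 2) * l2Norm (u t) ≤ xNorm s T u := le_ciSup h ⟨t, ht⟩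
  have h2 : 0 ≤ hsNorm s (u t) := Real.sqrt_nonneg _
  have h3 : t ^ (|s| / 2) * l2Norm (u t) ≤ xNorm s T u := by linarith
  have h4 : t ^ (s / 2) * t ^ (|s| / 2) = 1 := by
    rw [← Real.rpow_add ht.1, abs_of_neg hs]
    simp [neg_div]
  calc l2Norm (u t) = t ^ (s / 2) * (t ^ (|s| / 2) * l2Norm (u t)) := by
        rw [← mul_assoc, h4, one_mul]
    _ ≤ _ := mul_le_mul_of_nonneg_left h3 (Real.rpow_nonneg ht.1.le _)

lemma aux_sqrt (F : ℤ → ℝ) (t A e : ℝ) (ht : 0 < t) (h1 : t ≤ 1) (hA : 0 ≤ A)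
    (F0 : ∀ k, 0 ≤ F k)
    (hF : ∀ k : ℤ, F k ≤ A ^ 2 * t ^ (2 * e + 1 / 2) * (1 / (1 + t * (k:ℝ) ^ 2))) :
    √(2 * Real.pi * ∑' k, F k) ≤ 8 * A * t ^ e := by
  obtain ⟨a, b⟩ := aux_int t ht h1
  have hS := a.mul_left (A ^ 2 * t ^ (2 * e + 1 / 2))
  have h2 : ∑' k, F k ≤ A ^ 2 * t ^ (2 * e + 1 / 2) * (8 * t ^ (-(1/2) : ℝ)) := by
    refine ((hS.of_nonneg_of_le F0 hF).tsum_le_tsum hF hS).trans ?_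
    rw [tsum_mul_left]
    gcongr
  have h3 : t ^ (2 * e + 1 / 2) * t ^ (-(1/2) : ℝ) = (t ^ e) ^ 2 := by
    rw [← Real.rpow_add ht, ← Real.rpow_natCast, ← Real.rpow_mul ht.le]
    congr 1
    push_cast
    ring
  have h4 : ∑' k, F k ≤ 8 * (A * t ^ e) ^ 2 := by
    calc _ ≤ _ := h2
      _ = 8 * A ^ 2 * (t ^ (2 * e + 1 / 2) * t ^ (-(1/2) : ℝ)) := by ring
      _ = _ := by rw [h3]; ring
  apply Real.sqrt_le_iff.2 ⟨by positivity, ?_⟩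
  have h5 : 0 ≤ ∑' k, F k := tsum_nonneg F0
  nlinarith [Real.pi_lt_four, Real.pi_pos]

/-- Let η > 0, −1/2 < s < 0, 0 < T ≤ 1. For u, v in the space X_T^s of
continuous curves [0,T] → H^s(𝕋) with finite X_T^s norm, the Duhamel term satisfies
`‖∫_0^t S(t−t') ∂ₓ(uv)(t') dt'‖_{X_T^s} ≤ C(s,η) T^{(1+2s)/4} ‖u‖_{X_T^s} ‖v‖_{X_T^s}`. -/
theorem stmt11 (s η : ℝ) (hs1 : -(1/2) < s) (hs2 : s < 0) (hη : 0 < η) :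
    ∃ C > (0:ℝ), ∀ (β T : ℝ), 0 < T → T ≤ 1 → ∀ u v : ℝ → ℤ → ℂ,
      (∀ k : ℤ, ContinuousOn (fun t => u t k) (Set.Icc 0 T)) →
      (∀ k : ℤ, ContinuousOn (fun t => v t k) (Set.Icc 0 T)) →
      (∀ t ∈ Set.Ioc (0:ℝ) T, Summable fun k : ℤ => ‖u t k‖ ^ 2) →
      (∀ t ∈ Set.Ioc (0:ℝ) T, Summable fun k : ℤ => ‖v t k‖ ^ 2) →
      BddAbove (Set.range fun t : Set.Ioc (0:ℝ) T =>
        hsNorm s (u t) + (t : ℝ) ^ (|s| / 2) * l2Norm (u t)) →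
      BddAbove (Set.range fun t : Set.Ioc (0:ℝ) T =>
        hsNorm s (v t) + (t : ℝ) ^ (|s| / 2) * l2Norm (v t)) →
      ∀ t ∈ Set.Ioc (0:ℝ) T,
        hsNorm s (duhamel β η u v t) + t ^ (|s| / 2) * l2Norm (duhamel β η u v t) ≤
          C * T ^ ((1 + 2 * s) / 4) * xNorm s T u * xNorm s T v := by
  refine ⟨16 * (8 * (2 + 2 / η)), by positivity, ?_⟩
  intro β T hT hT1 u v _ _ hu hv hbu hbv t ht
  have ht0 := ht.1
  have ht1 : t ≤ 1 := ht.2.trans hT1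
  set U := xNorm s T u
  set V := xNorm s T v
  have hU : 0 ≤ U := aux_xnorm_nonneg s T u
  have hV : 0 ≤ V := aux_xnorm_nonneg s T v
  have hUV : 0 ≤ U * V := mul_nonneg hU hV
  set A := 8 * (2 + 2 / η) * (U * V) with hA
  have hA0 : 0 ≤ A := by positivity
  have D : ∀ k : ℤ, ‖duhamel β η u v t k‖ ≤ A * (|(k:ℝ)| * t ^ (1 + s) / (1 + t * (k:ℝ) ^ 2)) := by
    intro k
    set p := (k:ℝ) ^ 2 - |(k:ℝ)| with hp
    have hk2 : (k:ℝ) ^ 2 = |(k:ℝ)| ^ 2 := (sq_abs _).symm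
    have hp0 : 0 ≤ p := by
      rcases eq_or_ne k 0 with h | h
      · simp [hp, h]
      · have : (1:ℝ) ≤ |(k:ℝ)| := by exact_mod_cast Int.one_le_abs h
        rw [hp, hk2]
        nlinarith
    have h1 : ‖duhamel β η u v t k‖ ≤
        |(k:ℝ)| * (U * V) * (8 * t ^ (1 + s) / (1 + η * p * t)) := by
      apply aux_integral s (η * p) t hs1 hs2 (by positivity) ht0 _ _ (by positivity)
      intro r hr
      have hr' : r ∈ Set.Ioc 0 T := ⟨hr.1, hr.2.le.trans ht.2⟩
      rw [norm_mul, norm_mul, norm_mul, aux_symbol, Complex.norm_I, one_mul, Complex.norm_real,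
        Real.norm_eq_abs]
      have hc : ‖∑' j : ℤ, u r j * v r (k - j)‖ ≤ U * V * r ^ s := by
        refine (aux_conv _ _ (hu r hr') (hv r hr') k).trans ?_
        have e : r ^ s = r ^ (s/2) * r ^ (s/2) := by
          rw [← Real.rpow_add hr.1]; congr 1; ring
        calc _ ≤ (r ^ (s/2) * U) * (r ^ (s/2) * V) :=
              mul_le_mul (aux_xnorm s T u hbu hs2 r hr') (aux_xnorm s T v hbv hs2 r hr')
                (Real.sqrt_nonneg _) (mul_nonneg (Real.rpow_nonneg hr.1.le _) hU)
          _ = _ := by rw [e]; ring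
      calc _ ≤ Real.exp (-(η * p * (t - r))) * (|(k:ℝ)| * (U * V * r ^ s)) := by gcongr
        _ = _ := by ring
    refine h1.trans ?_
    have h2 : 1 / (1 + η * p * t) ≤ (2 + 2 / η) * (1 / (1 + t * (k:ℝ) ^ 2)) := by
      rw [mul_one_div, div_le_div_iff₀ (by positivity) (by positivity)]
      have h3 : (k:ℝ) ^ 2 ≤ 2 * p + 1 := by
        rw [hp, hk2]
        nlinarith [sq_nonneg (|(k:ℝ)| - 1)]
      have h4 : (2 + 2 / η) * (1 + η * p * t) = 2 + 2 * η * p * t + 2 / η + 2 * p * t := by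
        field_simp
        ring
      rw [h4]
      have h5 : 0 ≤ 2 * η * p * t := by positivity
      have h6 : 0 ≤ 2 / η := by positivity
      nlinarith [mul_le_mul_of_nonneg_left h3 ht0.le]
    calc _ = |(k:ℝ)| * (U * V) * (8 * t ^ (1 + s)) * (1 / (1 + η * p * t)) := by ring
      _ ≤ |(k:ℝ)| * (U * V) * (8 * t ^ (1 + s)) * ((2 + 2 / η) * (1 / (1 + t * (k:ℝ) ^ 2))) := by
          gcongr
      _ = _ := by rw [hA]; ring
  have D2 : ∀ k : ℤ, ‖duhamel β η u v t k‖ ^ 2 ≤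
      A ^ 2 * (t ^ (2 * s + 1) * ((t * (k:ℝ) ^ 2) / (1 + t * (k:ℝ) ^ 2) ^ 2)) := by
    intro k
    have e : (t ^ (1 + s)) ^ 2 = t ^ (2 * s + 1) * t := by
      rw [← Real.rpow_natCast, ← Real.rpow_mul ht0.le]
      nth_rw 3 [← Real.rpow_one t]
      rw [← Real.rpow_add ht0]
      congr 1
      push_cast
      ring
    calc _ ≤ (A * (|(k:ℝ)| * t ^ (1 + s) / (1 + t * (k:ℝ) ^ 2))) ^ 2 :=
          pow_le_pow_left₀ (norm_nonneg _) (D k) 2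
      _ = A ^ 2 * (|(k:ℝ)| ^ 2 * (t ^ (1 + s)) ^ 2 / (1 + t * (k:ℝ) ^ 2) ^ 2) := by
          rw [mul_pow A, div_pow, mul_pow |(k:ℝ)|]
      _ = _ := by rw [e, sq_abs]; ring
  have L : l2Norm (duhamel β η u v t) ≤ 8 * A * t ^ (s + 1 / 4) := by
    apply aux_sqrt _ t A _ ht0 ht1 hA0 (fun k => by positivity)
    intro k
    refine (D2 k).trans ?_
    rw [mul_assoc, show 2 * (s + 1 / 4) + 1 / 2 = 2 * s + 1 by ring]
    apply mul_le_mul_of_nonneg_left _ (by positivity)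
    apply mul_le_mul_of_nonneg_left _ (by positivity)
    rw [div_le_div_iff₀ (by positivity) (by positivity)]
    have : 0 ≤ t * (k:ℝ) ^ 2 := by positivity
    nlinarith
  have H : hsNorm s (duhamel β η u v t) ≤ 8 * A * t ^ ((1 + 2 * s) / 4) := by
    apply aux_sqrt _ t A _ ht0 ht1 hA0 (fun k => by positivity)
    intro k
    have hy : 0 ≤ t * (k:ℝ) ^ 2 := by positivity
    have e1 : t ^ (2 * s + 1) = t ^ (s + 1) * t ^ s := by
      rw [← Real.rpow_add ht0]; congr 1; ring
    have hw : 0 < t * (1 + (k:ℝ) ^ 2) := by positivity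
    have hwle : t * (1 + (k:ℝ) ^ 2) ≤ 1 + t * (k:ℝ) ^ 2 := by linarith
    have h1 : (t * (1 + (k:ℝ) ^ 2)) ^ s * (t * (k:ℝ) ^ 2) ≤ 1 + t * (k:ℝ) ^ 2 := by
      calc _ ≤ (t * (1 + (k:ℝ) ^ 2)) ^ s * (t * (1 + (k:ℝ) ^ 2)) := by gcongr; linarith
        _ = (t * (1 + (k:ℝ) ^ 2)) ^ (s + 1) := by rw [Real.rpow_add hw, Real.rpow_one]
        _ ≤ (1 + t * (k:ℝ) ^ 2) ^ (s + 1) := Real.rpow_le_rpow hw.le hwle (by linarith)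
        _ ≤ (1 + t * (k:ℝ) ^ 2) ^ (1:ℝ) :=
            Real.rpow_le_rpow_of_exponent_le (by linarith) (by linarith)
        _ = _ := Real.rpow_one _
    rw [Real.mul_rpow ht0.le (by positivity)] at h1
    rw [show 2 * ((1 + 2 * s) / 4) + 1 / 2 = s + 1 by ring]
    calc _ ≤ (1 + (k:ℝ) ^ 2) ^ s * _ := mul_le_mul_of_nonneg_left (D2 k) (by positivity)
      _ = A ^ 2 * t ^ (s + 1) * ((t ^ s * (1 + (k:ℝ) ^ 2) ^ s * (t * (k:ℝ) ^ 2)) /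
            (1 + t * (k:ℝ) ^ 2) ^ 2) := by rw [e1]; ring
      _ ≤ A ^ 2 * t ^ (s + 1) * ((1 + t * (k:ℝ) ^ 2) / (1 + t * (k:ℝ) ^ 2) ^ 2) := by gcongr
      _ = _ := by field_simp
  have E : t ^ (|s| / 2) * t ^ (s + 1 / 4) = t ^ ((1 + 2 * s) / 4) := by
    rw [← Real.rpow_add ht0, abs_of_neg hs2]; congr 1; ring
  have tT : t ^ ((1 + 2 * s) / 4) ≤ T ^ ((1 + 2 * s) / 4) :=
    Real.rpow_le_rpow ht0.le ht.2 (by linarith)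
  calc _ ≤ 8 * A * t ^ ((1 + 2 * s) / 4) + t ^ (|s| / 2) * (8 * A * t ^ (s + 1 / 4)) := by gcongr
    _ = 16 * A * t ^ ((1 + 2 * s) / 4) := by
        rw [show t ^ (|s| / 2) * (8 * A * t ^ (s + 1 / 4))
          = 8 * A * (t ^ (|s| / 2) * t ^ (s + 1 / 4)) by ring, E]
        ring
    _ ≤ 16 * A * T ^ ((1 + 2 * s) / 4) := by gcongr
    _ = _ := by rw [hA]; ring
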